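/- Single-dealer capacity bounds (Corollary 3): assume D = 1. The secret capacity C(𝔸), defined as the supremum of achievable rates R_1, satisfies min_{A∈𝔸} min_{U∈𝕌} ( I(Y_1; X_A) − I(Y_1; X_U) ) ≤ C(𝔸) ≤ min_{A∈𝔸} min_{U∈𝕌} I(Y_1; X_A | X_U). -/

import Mathlib

open scoped BigOperators
open Finset Filter

noncomputable section

namespace SecretSharing

open scoped Classical

/-! ### Basic Shannon information quantities (base 2) on finite probability spaces -/

variable {Ω : Type*} [Fintype Ω]

/-- `p` is a probability mass function on the finite type `Ω`. -/
def IsPMF (p : Ω → ℝ) : Prop := (∀ ω, 0 ≤ p ω) ∧ ∑ ω : Ω, p ω = 1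

/-- Probability that the random variable `X` takes the value `a` under `p`. -/
def prob (p : Ω → ℝ) {A : Type*} (X : Ω → A) (a : A) : ℝ :=
  ∑ ω : Ω, if X ω = a then p ω else 0

/-- Shannon entropy (in bits) of the random variable `X` under `p`. -/
def ent (p : Ω → ℝ) {A : Type*} [Fintype A] (X : Ω → A) : ℝ :=
  -∑ a : A, prob p X a * Real.logb 2 (prob p X a)

/-- Conditional Shannon entropy `H(X | Y)` in bits. -/
def condEnt (p : Ω → ℝ) {A B : Type*} [Fintype A] [Fintype B]
    (X : Ω → A) (Y : Ω → B) : ℝ :=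
  ent p (fun ω => (X ω, Y ω)) - ent p Y

/-- Mutual information `I(X ; Y)` in bits. -/
def mutInf (p : Ω → ℝ) {A B : Type*} [Fintype A] [Fintype B]
    (X : Ω → A) (Y : Ω → B) : ℝ :=
  ent p X + ent p Y - ent p (fun ω => (X ω, Y ω))

/-- Conditional mutual information `I(X ; Y | Z)` in bits. -/
def condMutInf (p : Ω → ℝ) {A B C : Type*} [Fintype A] [Fintype B] [Fintype C]
    (X : Ω → A) (Y : Ω → B) (Z : Ω → C) : ℝ :=
  condEnt p X Z - condEnt p X (fun ω => (Y ω, Z ω))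

/-! ### The distributed secret-sharing model -/

variable {L D : ℕ} {𝒳 : Fin L → Type} {𝒴 : Fin D → Type}
variable [∀ l, Fintype (𝒳 l)] [∀ d, Fintype (𝒴 d)]

/-- Sample space for one source symbol: the participants' observations and the
sub-dealers' observations. -/
abbrev Base (𝒳 : Fin L → Type) (𝒴 : Fin D → Type) : Type := (∀ l, 𝒳 l) × (∀ d, 𝒴 d)

/-- The i.i.d. product pmf of `p` over `n` source symbols. -/
def iid (p : Base 𝒳 𝒴 → ℝ) (n : ℕ) : (Fin n → Base 𝒳 𝒴) → ℝ :=
  fun ω => ∏ i, p (ω i)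

/-- Observations `X_T` of the set `T` of participants (single symbol). -/
def XT (T : Finset (Fin L)) : Base 𝒳 𝒴 → ∀ l : {l // l ∈ T}, 𝒳 l.1 :=
  fun ω l => ω.1 l.1

/-- Observations `Y_S` of the set `S` of sub-dealers (single symbol). -/
def YS (S : Finset (Fin D)) : Base 𝒳 𝒴 → ∀ d : {d // d ∈ S}, 𝒴 d.1 :=
  fun ω d => ω.2 d.1

/-- Observations `X_T^n` of the set `T` of participants over a block of length `n`. -/
def XTn (T : Finset (Fin L)) (n : ℕ) :
    (Fin n → Base 𝒳 𝒴) → ∀ l : {l // l ∈ T}, Fin n → 𝒳 l.1 :=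
  fun ω l i => (ω i).1 l.1

/-- Cardinality `⌈2^{n R_d}⌉` of the secret alphabet of sub-dealer `d`. -/
def secCard (R : Fin D → ℝ) (n : ℕ) (d : Fin D) : ℕ := ⌈(2:ℝ) ^ ((n : ℝ) * R d)⌉₊

/-- A secret-sharing strategy at blocklength `n` with rates `R`, for the access
structure `𝔸`: public messages, secrets, and decoders for authorized sets. -/
structure Strategy (𝒳 : Fin L → Type) (𝒴 : Fin D → Type)
    (𝔸 : Set (Finset (Fin L))) (R : Fin D → ℝ) (n : ℕ) where
  msgCard : Fin D → ℕ
  encM : ∀ d : Fin D, (Fin n → 𝒴 d) → Fin (msgCard d)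
  encS : ∀ d : Fin D, (Fin n → 𝒴 d) → Fin (secCard R n d)
  dec : ∀ A : Finset (Fin L), A ∈ 𝔸 →
    (∀ l : {l // l ∈ A}, Fin n → 𝒳 l.1) → (∀ d, Fin (msgCard d)) →
      ∀ d, Fin (secCard R n d)

variable {𝔸 : Set (Finset (Fin L))} {R : Fin D → ℝ} {n : ℕ}

/-- The public communication `M_𝒟` as a random variable. -/
def Strategy.Mrv (σ : Strategy 𝒳 𝒴 𝔸 R n) :
    (Fin n → Base 𝒳 𝒴) → ∀ d, Fin (σ.msgCard d) :=
  fun ω d => σ.encM d (fun i => (ω i).2 d)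

/-- The secrets `S_𝒟` as a random variable. -/
def Strategy.Srv (σ : Strategy 𝒳 𝒴 𝔸 R n) :
    (Fin n → Base 𝒳 𝒴) → ∀ d, Fin (secCard R n d) :=
  fun ω d => σ.encS d (fun i => (ω i).2 d)

/-- The estimate `Ŝ_𝒟(A)` computed by the authorized set `A`. -/
def Strategy.ShatRv (σ : Strategy 𝒳 𝒴 𝔸 R n) (A : Finset (Fin L)) (hA : A ∈ 𝔸) :
    (Fin n → Base 𝒳 𝒴) → ∀ d, Fin (secCard R n d) :=
  fun ω => σ.dec A hA (fun l i => (ω i).1 l.1) (σ.Mrv ω)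

/-- Error probability `P[Ŝ_𝒟(A) ≠ S_𝒟]`. -/
def Strategy.err (p : Base 𝒳 𝒴 → ℝ) (σ : Strategy 𝒳 𝒴 𝔸 R n)
    (A : Finset (Fin L)) (hA : A ∈ 𝔸) : ℝ :=
  ∑ ω : Fin n → Base 𝒳 𝒴, if σ.ShatRv A hA ω ≠ σ.Srv ω then iid p n ω else 0

/-- Information leakage `I(S_𝒟 ; M_𝒟, X_U^n)` to the set `U` of participants. -/
def Strategy.leak (p : Base 𝒳 𝒴 → ℝ) (σ : Strategy 𝒳 𝒴 𝔸 R n)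
    (U : Finset (Fin L)) : ℝ :=
  mutInf (iid p n) σ.Srv (fun ω => (σ.Mrv ω, XTn U n ω))

/-- Uniformity defect `log₂|𝒮_𝒟| - H(S_𝒟)`. -/
def Strategy.unif (p : Base 𝒳 𝒴 → ℝ) (σ : Strategy 𝒳 𝒴 𝔸 R n) : ℝ :=
  Real.logb 2 (∏ d, (secCard R n d : ℝ)) - ent (iid p n) σ.Srv

/-- Achievability of the rate tuple `R` for access structure `𝔸` and
unauthorized sets `𝕌`: a sequence of strategies with vanishing error
probability (for every authorized set), vanishing leakage (for every
unauthorized set), and vanishing uniformity defect. -/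
def Achievable (p : Base 𝒳 𝒴 → ℝ) (𝔸 𝕌 : Set (Finset (Fin L)))
    (R : Fin D → ℝ) : Prop :=
  (∀ d, 0 ≤ R d) ∧
  ∃ σ : (n : ℕ) → Strategy 𝒳 𝒴 𝔸 R n,
    (∀ A : Finset (Fin L), ∀ hA : A ∈ 𝔸,
      Tendsto (fun n => (σ n).err p A hA) atTop (nhds 0)) ∧
    (∀ U ∈ 𝕌, Tendsto (fun n => (σ n).leak p U) atTop (nhds 0)) ∧
    Tendsto (fun n => (σ n).unif p) atTop (nhds 0)

/-- `𝔸` is a monotone access structure: nonempty, not containing `∅`, and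
closed under taking supersets. -/
def MonotoneAccess (𝔸 : Set (Finset (Fin L))) : Prop :=
  𝔸.Nonempty ∧ ∅ ∉ 𝔸 ∧ ∀ A ∈ 𝔸, ∀ T : Finset (Fin L), A ⊆ T → T ∈ 𝔸

/-! ### Generic entropy calculus -/

lemma sum_prob_mul {Ω A : Type*} [Fintype Ω] [Fintype A] (p : Ω → ℝ) (X : Ω → A) (g : A → ℝ) :
    ∑ a, prob p X a * g a = ∑ ω, p ω * g (X ω) := by
  simp only [prob, Finset.sum_mul]
  rw [Finset.sum_comm]
  refine Finset.sum_congr rfl fun ω _ => ?_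
  rw [Finset.sum_eq_single (X ω)]
  · simp
  · intro b _ hb
    simp [Ne.symm hb]
  · simp

lemma ent_eq {Ω A : Type*} [Fintype Ω] [Fintype A] (p : Ω → ℝ) (X : Ω → A) :
    ent p X = -∑ ω, p ω * Real.logb 2 (prob p X (X ω)) := by
  rw [ent, sum_prob_mul p X (fun a => Real.logb 2 (prob p X a))]

lemma prob_congr {Ω A B : Type*} [Fintype Ω] (p : Ω → ℝ) (X : Ω → A) (Y : Ω → B) (ω : Ω)
    (h : ∀ ω', X ω' = X ω ↔ Y ω' = Y ω) : prob p X (X ω) = prob p Y (Y ω) := by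
  simp only [prob, h]

lemma ent_congr {Ω A B : Type*} [Fintype Ω] [Fintype A] [Fintype B] (p : Ω → ℝ)
    (X : Ω → A) (Y : Ω → B) (h : ∀ ω ω', X ω' = X ω ↔ Y ω' = Y ω) : ent p X = ent p Y := by
  rw [ent_eq, ent_eq]
  congr 1
  refine Finset.sum_congr rfl fun ω _ => ?_
  rw [prob_congr p X Y ω (h ω)]

lemma prob_nonneg {Ω A : Type*} [Fintype Ω] {p : Ω → ℝ} (hp : IsPMF p) (X : Ω → A) (a : A) :
    0 ≤ prob p X a :=
  Finset.sum_nonneg fun ω _ => by split_ifs <;> simp [hp.1 ω]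

lemma prob_ge {Ω A : Type*} [Fintype Ω] {p : Ω → ℝ} (hp : IsPMF p) (X : Ω → A) (ω : Ω) :
    p ω ≤ prob p X (X ω) := by
  have := Finset.single_le_sum (f := fun ω' => if X ω' = X ω then p ω' else 0)
    (fun ω' _ => by split_ifs <;> simp [hp.1 ω']) (Finset.mem_univ ω)
  simpa [prob] using this

lemma prob_pos {Ω A : Type*} [Fintype Ω] {p : Ω → ℝ} (hp : IsPMF p) (X : Ω → A) (ω : Ω)
    (h : 0 < p ω) : 0 < prob p X (X ω) := lt_of_lt_of_le h (prob_ge hp X ω)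

lemma sum_prob {Ω A : Type*} [Fintype Ω] [Fintype A] {p : Ω → ℝ} (hp : IsPMF p) (X : Ω → A) :
    ∑ a, prob p X a = 1 := by
  have := sum_prob_mul p X (fun _ => 1)
  simpa [hp.2] using this

/-- Marginalization. -/
lemma sum_prob_pair {Ω A B : Type*} [Fintype Ω] [Fintype A] (p : Ω → ℝ)
    (X : Ω → A) (Z : Ω → B) (b : B) :
    ∑ a, prob p (fun ω => (X ω, Z ω)) (a, b) = prob p Z b := by
  simp only [prob]
  rw [Finset.sum_comm]
  refine Finset.sum_congr rfl fun ω _ => ?_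
  rw [Finset.sum_eq_single (X ω)]
  · simp
  · intro c _ hc
    simp [Ne.symm hc]
  · simp

lemma prob_mono {Ω A B : Type*} [Fintype Ω] {p : Ω → ℝ} (hp : IsPMF p)
    (X : Ω → A) (Z : Ω → B) (ω : Ω) (h : ∀ ω', X ω' = X ω → Z ω' = Z ω) :
    prob p X (X ω) ≤ prob p Z (Z ω) := by
  refine Finset.sum_le_sum fun ω' _ => ?_
  by_cases h1 : X ω' = X ω
  · simp [h1, h ω' h1]
  · simp only [h1, if_false]
    split_ifs <;> simp [hp.1 ω']

lemma ent_mono {Ω A B : Type*} [Fintype Ω] [Fintype A] [Fintype B] {p : Ω → ℝ} (hp : IsPMF p)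
    (X : Ω → A) (Z : Ω → B) (h : ∀ ω ω', X ω' = X ω → Z ω' = Z ω) : ent p Z ≤ ent p X := by
  rw [ent_eq, ent_eq, neg_le_neg_iff]
  refine Finset.sum_le_sum fun ω _ => ?_
  rcases (hp.1 ω).eq_or_lt with h0 | h0
  · simp [← h0]
  · refine mul_le_mul_of_nonneg_left ?_ h0.le
    exact Real.logb_le_logb_of_le (by norm_num) (prob_pos hp X ω h0) (prob_mono hp X Z ω (h ω))

lemma gibbs {Ω A : Type*} [Fintype Ω] [Fintype A] {p : Ω → ℝ} (hp : IsPMF p) (X : Ω → A)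
    (r : A → ℝ) (hr : ∀ a, 0 ≤ r a) (hr1 : ∑ a, r a ≤ 1) (hpos : ∀ ω, 0 < p ω → 0 < r (X ω)) :
    ent p X ≤ -∑ ω, p ω * Real.logb 2 (r (X ω)) := by
  rw [ent_eq, neg_le_neg_iff]
  have hl : (0:ℝ) < Real.log 2 := Real.log_pos (by norm_num)
  have key : ∀ ω, p ω * Real.logb 2 (r (X ω)) ≤ p ω * Real.logb 2 (prob p X (X ω)) +
      (p ω * (r (X ω) / prob p X (X ω)) - p ω) / Real.log 2 := by
    intro ω
    rcases (hp.1 ω).eq_or_lt with h0 | h0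
    · simp [← h0]
    · have h1 := hpos ω h0
      have h2 := prob_pos hp X ω h0
      have h3 := Real.log_le_sub_one_of_pos (div_pos h1 h2)
      rw [Real.log_div h1.ne' h2.ne'] at h3
      have : p ω * Real.logb 2 (prob p X (X ω)) +
        (p ω * (r (X ω) / prob p X (X ω)) - p ω) / Real.log 2 =
        p ω * ((Real.log (prob p X (X ω)) + (r (X ω) / prob p X (X ω) - 1)) / Real.log 2) := by
        rw [Real.logb]; ring
      rw [this, Real.logb]
      refine mul_le_mul_of_nonneg_left ?_ h0.le
      gcongr
      linarith
  have hs : ∑ ω, p ω * (r (X ω) / prob p X (X ω)) ≤ 1 := by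
    rw [← sum_prob_mul p X (fun a => r a / prob p X a)]
    refine le_trans (Finset.sum_le_sum fun a _ => ?_) hr1
    rcases (prob_nonneg hp X a).eq_or_lt with h0 | h0
    · simp [← h0, hr a]
    · rw [mul_div_cancel₀ _ h0.ne']
  calc _ ≤ ∑ ω, (p ω * Real.logb 2 (prob p X (X ω)) +
      (p ω * (r (X ω) / prob p X (X ω)) - p ω) / Real.log 2) := Finset.sum_le_sum fun ω _ => key ω
    _ = ∑ ω, p ω * Real.logb 2 (prob p X (X ω)) +
      (∑ ω, p ω * (r (X ω) / prob p X (X ω)) - 1) / Real.log 2 := by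
        rw [Finset.sum_add_distrib, ← Finset.sum_div, Finset.sum_sub_distrib, hp.2]
    _ ≤ _ := by
        have : (∑ ω, p ω * (r (X ω) / prob p X (X ω)) - 1) / Real.log 2 ≤ 0 :=
          div_nonpos_of_nonpos_of_nonneg (by linarith) hl.le
        linarith

lemma ent_le_log {Ω A : Type*} [Fintype Ω] [Fintype A] {p : Ω → ℝ} (hp : IsPMF p) (X : Ω → A) :
    ent p X ≤ Real.logb 2 (Fintype.card A) := by
  have hne : Nonempty A := by
    by_contra h
    have : IsEmpty Ω := ⟨fun ω => h ⟨X ω⟩⟩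
    have h2 := hp.2
    simp at h2
  have hc : (0:ℝ) < Fintype.card A := by exact_mod_cast Fintype.card_pos
  refine (gibbs hp X (fun _ => (Fintype.card A : ℝ)⁻¹) (fun _ => by positivity) ?_
    (fun _ _ => by positivity)).trans ?_
  · simp [hc.ne']
  · rw [← Finset.sum_mul, hp.2, Real.logb_inv]
    simp

lemma submod {Ω A B C : Type*} [Fintype Ω] [Fintype A] [Fintype B] [Fintype C] {p : Ω → ℝ}
    (hp : IsPMF p) (X : Ω → A) (Y : Ω → B) (Z : Ω → C) :
    ent p (fun ω => (X ω, Y ω, Z ω)) + ent p Z ≤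
      ent p (fun ω => (X ω, Z ω)) + ent p (fun ω => (Y ω, Z ω)) := by
  have := gibbs hp (fun ω => (X ω, Y ω, Z ω))
    (fun t => prob p (fun ω => (X ω, Z ω)) (t.1, t.2.2) * prob p (fun ω => (Y ω, Z ω)) t.2
      / prob p Z t.2.2)
    (fun t => div_nonneg (mul_nonneg (prob_nonneg hp _ _) (prob_nonneg hp _ _))
      (prob_nonneg hp _ _)) ?_ ?_
  · refine le_trans (add_le_add_left this _) ?_
    rw [ent_eq p Z, ent_eq, ent_eq, ← neg_add, ← neg_add, ← Finset.sum_add_distrib,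
      ← Finset.sum_add_distrib, neg_le_neg_iff]
    refine Finset.sum_le_sum fun ω _ => ?_
    rcases (hp.1 ω).eq_or_lt with h0 | h0
    · simp [← h0]
    · have h1 := prob_pos hp (fun ω => (X ω, Z ω)) ω h0
      have h2 := prob_pos hp (fun ω => (Y ω, Z ω)) ω h0
      have h3 := prob_pos hp Z ω h0
      rw [Real.logb_div (mul_pos h1 h2).ne' h3.ne', Real.logb_mul h1.ne' h2.ne']
      apply le_of_eq; ring
  · rw [Fintype.sum_prod_type]
    simp only
    rw [Finset.sum_comm]
    have : ∀ t : B × C, ∑ x : A, prob p (fun ω => (X ω, Z ω)) (x, t.2) *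
        prob p (fun ω => (Y ω, Z ω)) t / prob p Z t.2 ≤ prob p (fun ω => (Y ω, Z ω)) t := by
      intro t
      rw [← Finset.sum_div, ← Finset.sum_mul, sum_prob_pair]
      rcases (prob_nonneg hp Z t.2).eq_or_lt with h0 | h0
      · simp [← h0, prob_nonneg hp]
      · rw [mul_div_cancel_left₀ _ h0.ne']
    refine (Finset.sum_le_sum fun t _ => this t).trans ?_
    rw [sum_prob hp]
  · intro ω h0
    exact div_pos (mul_pos (prob_pos hp (fun ω => (X ω, Z ω)) ω h0)
      (prob_pos hp (fun ω => (Y ω, Z ω)) ω h0)) (prob_pos hp Z ω h0)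

lemma fano {Ω A B : Type*} [Fintype Ω] [Fintype A] [Fintype B] {p : Ω → ℝ}
    (hp : IsPMF p) (S : Ω → A) (V : Ω → B) (d : B → A) :
    ent p (fun ω => (S ω, V ω)) - ent p V ≤
      1 + (∑ ω, if d (V ω) ≠ S ω then p ω else 0) * Real.logb 2 (Fintype.card A) := by
  have hne : Nonempty A := by
    by_contra h
    have : IsEmpty Ω := ⟨fun ω => h ⟨S ω⟩⟩
    have h2 := hp.2
    simp at h2
  have hc : (0:ℝ) < Fintype.card A := by exact_mod_cast Fintype.card_pos
  have hc1 : (1:ℝ) ≤ Fintype.card A := by exact_mod_cast Fintype.card_pos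
  have := gibbs hp (fun ω => (S ω, V ω))
    (fun t => ((if d t.2 = t.1 then (1/2:ℝ) else 0) + 1/2 * (Fintype.card A : ℝ)⁻¹) * prob p V t.2)
    (fun t => mul_nonneg (by split_ifs <;> positivity) (prob_nonneg hp _ _)) ?_ ?_
  · refine le_trans (sub_le_sub_right this _) ?_
    rw [ent_eq p V]
    have h1 : (1:ℝ) = ∑ ω, p ω := hp.2.symm
    conv_rhs => rw [h1]
    rw [Finset.sum_mul, ← Finset.sum_add_distrib, sub_neg_eq_add, neg_add_eq_sub,
      ← Finset.sum_sub_distrib]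
    refine Finset.sum_le_sum fun ω _ => ?_
    rcases (hp.1 ω).eq_or_lt with h0 | h0
    · simp [← h0]
    · have h3 := prob_pos hp V ω h0
      have h4 : (0:ℝ) < (if d (V ω) = S ω then (1/2:ℝ) else 0) + 1/2 * (Fintype.card A : ℝ)⁻¹ := by
        split_ifs <;> positivity
      simp only
      rw [Real.logb_mul h4.ne' h3.ne']
      by_cases hd : d (V ω) = S ω
      · simp only [hd, if_true, ne_eq, not_true_eq_false, if_false]
        have : Real.logb 2 (1/2) ≤ Real.logb 2 (1/2 + 1/2 * (Fintype.card A : ℝ)⁻¹) :=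
          Real.logb_le_logb_of_le (by norm_num) (by norm_num)
            (by have : 0 < (Fintype.card A : ℝ)⁻¹ := by positivity
                linarith)
        have h5 : Real.logb 2 (1/2) = -1 := by
          rw [one_div, Real.logb_inv, Real.logb_self_eq_one (by norm_num)]
        rw [h5] at this
        nlinarith
      · simp only [hd, if_false, ne_eq, not_false_eq_true, if_true, zero_add]
        rw [one_div, ← mul_inv, Real.logb_inv, Real.logb_mul (by norm_num) hc.ne',
          Real.logb_self_eq_one (by norm_num)]
        apply le_of_eq; ring
  · rw [Fintype.sum_prod_type, Finset.sum_comm]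
    simp only
    refine le_trans (le_of_eq ?_) (sum_prob hp V).le
    refine Finset.sum_congr rfl fun v _ => ?_
    rw [← Finset.sum_mul, Finset.sum_add_distrib]
    have h6 : (Fintype.card A : ℝ) * (1 / 2 * (Fintype.card A : ℝ)⁻¹) = 1 / 2 := by
      field_simp
    simp only [Finset.sum_ite_eq, Finset.mem_univ, if_true, Finset.sum_const, Finset.card_univ,
      nsmul_eq_mul, h6]
    ring
  · intro ω h0
    refine mul_pos ?_ (prob_pos hp V ω h0)
    split_ifs <;> positivity

/-! ### Product distributions -/

lemma sum_prod_pi {Ω : Type*} [Fintype Ω] (n : ℕ) (f : Fin n → Ω → ℝ) :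
    ∑ ω : Fin n → Ω, ∏ i, f i (ω i) = ∏ i, ∑ a, f i a := by
  rw [Finset.prod_univ_sum]
  simp

lemma isPMF_pi {Ω : Type*} [Fintype Ω] {p : Ω → ℝ} (hp : IsPMF p) (n : ℕ) :
    IsPMF (fun ω : Fin n → Ω => ∏ i, p (ω i)) := by
  refine ⟨fun ω => Finset.prod_nonneg fun i _ => hp.1 _, ?_⟩
  rw [sum_prod_pi n (fun _ => p)]
  simp [hp.2]

lemma prob_pi {Ω A : Type*} [Fintype Ω] (p : Ω → ℝ) (n : ℕ) (Z : Ω → A) (z : Fin n → A) :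
    prob (fun ω : Fin n → Ω => ∏ i, p (ω i)) (fun ω i => Z (ω i)) z =
      ∏ i, prob p Z (z i) := by
  simp only [prob]
  rw [← sum_prod_pi n (fun i a => if Z a = z i then p a else 0)]
  refine Finset.sum_congr rfl fun ω _ => ?_
  by_cases h : ∀ i, Z (ω i) = z i
  · rw [if_pos (funext h)]
    simp [h]
  · rw [if_neg (fun h' => h (fun i => congrFun h' i))]
    push Not at h
    obtain ⟨i, hi⟩ := h
    exact (Finset.prod_eq_zero (Finset.mem_univ i) (by simp [hi])).symm

lemma expect_pi {Ω : Type*} [Fintype Ω] {p : Ω → ℝ} (hp : IsPMF p) (n : ℕ) (f : Ω → ℝ)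
    (j : Fin n) :
    ∑ ω : Fin n → Ω, (∏ i, p (ω i)) * f (ω j) = ∑ a, p a * f a := by
  have h1 : ∀ ω : Fin n → Ω, (∏ i, p (ω i)) * f (ω j) =
      ∏ i, (p (ω i) * if i = j then f (ω i) else 1) := by
    intro ω
    rw [Finset.prod_mul_distrib]
    simp
  simp only [h1]
  rw [sum_prod_pi n (fun i a => p a * if i = j then f a else 1)]
  rw [Finset.prod_eq_single j]
  · simp
  · intro b _ hb
    simp [hb, hp.2]
  · simp

lemma ent_pi {Ω A : Type*} [Fintype Ω] [Fintype A] {p : Ω → ℝ} (hp : IsPMF p) (n : ℕ)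
    (Z : Ω → A) :
    ent (fun ω : Fin n → Ω => ∏ i, p (ω i)) (fun ω i => Z (ω i)) = n * ent p Z := by
  rw [ent_eq, ent_eq]
  have h1 : ∀ ω : Fin n → Ω, (∏ i, p (ω i)) *
      Real.logb 2 (prob (fun ω : Fin n → Ω => ∏ i, p (ω i)) (fun ω i => Z (ω i))
        (fun i => Z (ω i))) =
      ∑ j, (∏ i, p (ω i)) * Real.logb 2 (prob p Z (Z (ω j))) := by
    intro ω
    rw [← Finset.mul_sum]
    by_cases h0 : ∏ i, p (ω i) = 0
    · simp [h0]
    · congr 1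
      rw [prob_pi, Real.logb_prod]
      intro i _
      have : p (ω i) ≠ 0 := fun h => h0 (Finset.prod_eq_zero (Finset.mem_univ i) h)
      exact (prob_pos hp Z _ (lt_of_le_of_ne (hp.1 _) this.symm)).ne'
  simp only [h1]
  rw [Finset.sum_comm]
  simp only [expect_pi hp n (fun a => Real.logb 2 (prob p Z (Z a)))]
  simp

/-! ### Converse -/

lemma converse_n {L : ℕ} {𝒳 : Fin L → Type} {𝒴 : Fin 1 → Type}
    [∀ l, Fintype (𝒳 l)] [∀ d, Fintype (𝒴 d)]
    {p : Base 𝒳 𝒴 → ℝ} (hp : IsPMF p) {𝔸 : Set (Finset (Fin L))} {R : Fin 1 → ℝ} {n : ℕ}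
    (σ : Strategy 𝒳 𝒴 𝔸 R n) (A : Finset (Fin L)) (hA : A ∈ 𝔸) (U : Finset (Fin L)) :
    Real.logb 2 (secCard R n 0) ≤ σ.leak p U + σ.unif p +
      (1 + σ.err p A hA * Real.logb 2 (secCard R n 0)) +
      n * condMutInf p (fun ω => ω.2 0) (XT A) (XT U) := by
  have hq : IsPMF (iid p n) := isPMF_pi hp n
  set Y : (Fin n → Base 𝒳 𝒴) → (Fin n → 𝒴 0) := fun ω i => (ω i).2 0 with hY
  have s1 := submod hq (XTn A n) σ.Mrv (XTn U n)
  have s2 := submod hq (XTn A n) Y (fun ω => (σ.Srv ω, σ.Mrv ω, XTn U n ω))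
  have hf := fano hq σ.Srv (fun ω => (σ.Mrv ω, XTn A n ω, XTn U n ω))
    (fun v => σ.dec A hA v.2.1 v.1)
  have hcard : (Fintype.card (∀ d, Fin (secCard R n d)) : ℝ) = secCard R n 0 := by
    simp
  rw [hcard] at hf
  replace hf := hf.trans (b := _)
    (c := 1 + σ.err p A hA * Real.logb 2 (secCard R n 0)) (le_of_eq (by
      congr 2
      unfold Strategy.err
      refine Finset.sum_congr rfl fun ω _ => ?_
      simp only [Strategy.ShatRv]
      congr 1))
  have hSY : ∀ ω ω', Y ω' = Y ω → σ.Srv ω' = σ.Srv ω := by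
    intro ω ω' h
    funext d
    have hd : d = 0 := Subsingleton.elim _ _
    subst hd
    exact congrArg (σ.encS 0) h
  have hMY : ∀ ω ω', Y ω' = Y ω → σ.Mrv ω' = σ.Mrv ω := by
    intro ω ω' h
    funext d
    have hd : d = 0 := Subsingleton.elim _ _
    subst hd
    exact congrArg (σ.encM 0) h
  have hX : ∀ (T : Finset (Fin L)) (ω ω' : Fin n → Base 𝒳 𝒴),
      XTn T n ω' = XTn T n ω ↔ ∀ i, XT T (ω' i) = XT T (ω i) := by
    intro T ω ω'
    constructor
    · intro h i
      funext l
      exact congrFun (congrFun h l) i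
    · intro h
      funext l i
      exact congrFun (h i) l
  have hYi : ∀ (ω ω' : Fin n → Base 𝒳 𝒴), Y ω' = Y ω ↔ ∀ i, (ω' i).2 0 = (ω i).2 0 :=
    fun ω ω' => funext_iff
  -- single letterization
  have e1 : ent (iid p n) (fun ω => (Y ω, XTn U n ω)) =
      n * ent p (fun ω => (ω.2 0, XT U ω)) := by
    rw [← ent_pi hp n]
    refine ent_congr _ _ _ fun ω ω' => ?_
    simp only [Prod.mk.injEq, hX, hYi, funext_iff (f := fun i => (_, _)), forall_and]
  have e2 : ent (iid p n) (XTn U n) = n * ent p (XT U) := by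
    rw [← ent_pi hp n]
    refine ent_congr _ _ _ fun ω ω' => ?_
    rw [hX, funext_iff]
  have e3 : ent (iid p n) (fun ω => (Y ω, XTn A n ω, XTn U n ω)) =
      n * ent p (fun ω => (ω.2 0, XT A ω, XT U ω)) := by
    rw [← ent_pi hp n]
    refine ent_congr _ _ _ fun ω ω' => ?_
    simp only [Prod.mk.injEq, hX, hYi, funext_iff (f := fun i => (_, _)), forall_and]
  have e4 : ent (iid p n) (fun ω => (XTn A n ω, XTn U n ω)) =
      n * ent p (fun ω => (XT A ω, XT U ω)) := by
    rw [← ent_pi hp n]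
    refine ent_congr _ _ _ fun ω ω' => ?_
    simp only [Prod.mk.injEq, hX, funext_iff (f := fun i => (_, _)), forall_and]
  -- relabelings
  have r1 : ent (iid p n) (fun ω => (XTn A n ω, σ.Mrv ω, XTn U n ω)) =
      ent (iid p n) (fun ω => (σ.Mrv ω, XTn A n ω, XTn U n ω)) := by
    refine ent_congr _ _ _ fun ω ω' => ?_
    simp only [Prod.mk.injEq]; tauto
  have r2 : ent (iid p n) (fun ω => (XTn A n ω, Y ω, σ.Srv ω, σ.Mrv ω, XTn U n ω)) =
      ent (iid p n) (fun ω => (Y ω, XTn A n ω, XTn U n ω)) := by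
    refine ent_congr _ _ _ fun ω ω' => ?_
    simp only [Prod.mk.injEq]
    have := hSY ω ω'
    have := hMY ω ω'
    tauto
  have r3 : ent (iid p n) (fun ω => (Y ω, σ.Srv ω, σ.Mrv ω, XTn U n ω)) =
      ent (iid p n) (fun ω => (Y ω, XTn U n ω)) := by
    refine ent_congr _ _ _ fun ω ω' => ?_
    simp only [Prod.mk.injEq]
    have := hSY ω ω'
    have := hMY ω ω'
    tauto
  have r4 : ent (iid p n) (fun ω => (XTn A n ω, σ.Srv ω, σ.Mrv ω, XTn U n ω)) =
      ent (iid p n) (fun ω => (σ.Srv ω, σ.Mrv ω, XTn A n ω, XTn U n ω)) := by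
    refine ent_congr _ _ _ fun ω ω' => ?_
    simp only [Prod.mk.injEq]; tauto
  have hl : σ.leak p U = ent (iid p n) σ.Srv + ent (iid p n) (fun ω => (σ.Mrv ω, XTn U n ω)) -
    ent (iid p n) (fun ω => (σ.Srv ω, σ.Mrv ω, XTn U n ω)) := rfl
  have hu : σ.unif p = Real.logb 2 (secCard R n 0) - ent (iid p n) σ.Srv := by
    simp [Strategy.unif]
  have hc : (n:ℝ) * condMutInf p (fun ω => ω.2 0) (XT A) (XT U) =
      n * ent p (fun ω => (ω.2 0, XT U ω)) - n * ent p (XT U) -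
      (n * ent p (fun ω => (ω.2 0, XT A ω, XT U ω)) - n * ent p (fun ω => (XT A ω, XT U ω))) := by
    simp only [condMutInf, condEnt]; ring
  rw [hc, hl, hu, ← e1, ← e2, ← e3, ← e4]
  rw [r1] at s1
  rw [r2, r3, r4] at s2
  linarith

lemma converse {L : ℕ} {𝒳 : Fin L → Type} {𝒴 : Fin 1 → Type}
    [∀ l, Fintype (𝒳 l)] [∀ d, Fintype (𝒴 d)]
    {p : Base 𝒳 𝒴 → ℝ} (hp : IsPMF p) {𝔸 : Set (Finset (Fin L))} {ρ : ℝ}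
    (h : Achievable p 𝔸 𝔸ᶜ (fun _ : Fin 1 => ρ)) (A : Finset (Fin L)) (hA : A ∈ 𝔸)
    (U : Finset (Fin L)) (hU : U ∉ 𝔸) :
    ρ ≤ condMutInf p (fun ω => ω.2 0) (XT A) (XT U) := by
  obtain ⟨hR, σ, he, hl, hu⟩ := h
  have hρ : 0 ≤ ρ := hR 0
  have he := he A hA
  have hl := hl U hU
  set I := condMutInf p (fun ω => ω.2 0) (XT A) (XT U) with hI
  have key : ∀ᶠ n : ℕ in atTop, ρ ≤
      ((σ n).leak p U + (σ n).unif p + 1) * (n:ℝ)⁻¹ +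
        (σ n).err p A hA * (ρ + (n:ℝ)⁻¹) + I := by
    filter_upwards [eventually_gt_atTop 0] with n hn
    have hn' : (0:ℝ) < n := by exact_mod_cast hn
    have h1 := converse_n hp (σ n) A hA U
    have hq : IsPMF (iid p n) := isPMF_pi hp n
    have he0 : 0 ≤ (σ n).err p A hA :=
      Finset.sum_nonneg fun ω _ => by split_ifs <;> simp [hq.1 ω]
    have hlow : (n:ℝ) * ρ ≤ Real.logb 2 (secCard (fun _ : Fin 1 => ρ) n 0) := by
      rw [Real.le_logb_iff_rpow_le (by norm_num) (by
        have : (0:ℝ) < 2 ^ ((n:ℝ) * ρ) := by positivity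
        exact_mod_cast Nat.ceil_pos.mpr this)]
      exact Nat.le_ceil _
    have hup : Real.logb 2 (secCard (fun _ : Fin 1 => ρ) n 0) ≤ n * ρ + 1 := by
      have h2 : (1:ℝ) ≤ 2 ^ ((n:ℝ) * ρ) := Real.one_le_rpow (by norm_num) (by positivity)
      rw [Real.logb_le_iff_le_rpow (by norm_num) (by
        have : (0:ℝ) < 2 ^ ((n:ℝ) * ρ) := by positivity
        exact_mod_cast Nat.ceil_pos.mpr this), Real.rpow_add (by norm_num), Real.rpow_one]
      have := (Nat.ceil_lt_add_one (by positivity : (0:ℝ) ≤ 2 ^ ((n:ℝ) * ρ))).le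
      simp only [secCard]
      linarith
    have h3 : (n:ℝ) * ρ ≤ n * (((σ n).leak p U + (σ n).unif p + 1) * (n:ℝ)⁻¹ +
        (σ n).err p A hA * (ρ + (n:ℝ)⁻¹) + I) := by
      have h4 : (n:ℝ) * (((σ n).leak p U + (σ n).unif p + 1) * (n:ℝ)⁻¹ +
        (σ n).err p A hA * (ρ + (n:ℝ)⁻¹) + I) = ((σ n).leak p U + (σ n).unif p + 1) +
        (σ n).err p A hA * (n * ρ + 1) + n * I := by
        field_simp
      rw [h4]
      have := mul_le_mul_of_nonneg_left hup he0
      linarith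
    exact le_of_mul_le_mul_left h3 hn'
  have hinv : Tendsto (fun n : ℕ => (n:ℝ)⁻¹) atTop (nhds 0) := tendsto_inv_atTop_nhds_zero_nat
  have hlim : Tendsto (fun n : ℕ => ((σ n).leak p U + (σ n).unif p + 1) * (n:ℝ)⁻¹ +
        (σ n).err p A hA * (ρ + (n:ℝ)⁻¹) + I) atTop
      (nhds (((0 + 0 + 1) * 0) + 0 * (ρ + 0) + I)) :=
    ((((hl.add hu).add_const 1).mul hinv).add (he.mul (hinv.const_add ρ))).add_const I
  have := ge_of_tendsto hlim key
  simpa using this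

/-! ### Random binning -/

lemma collision {α B : Type*} [Fintype (α → B)] [Fintype B] [Nonempty B] {y y' : α}
    (h : y' ≠ y) :
    ∑ f : α → B, (if f y' = f y then (1:ℝ) else 0) =
      (Fintype.card (α → B) : ℝ) * (Fintype.card B : ℝ)⁻¹ := by
  have hc : (0:ℝ) < Fintype.card B := by exact_mod_cast Fintype.card_pos
  rw [← div_eq_mul_inv, eq_div_iff hc.ne', Finset.sum_boole]
  have e : {f : α → B // f y' = f y} × B ≃ (α → B) :=
    { toFun := fun t => Function.update t.1.1 y' t.2
      invFun := fun g => (⟨Function.update g y' (g y), by simp [Function.update_of_ne h.symm]⟩, g y')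
      left_inv := by
        rintro ⟨⟨f, hf⟩, b⟩
        ext z
        · by_cases hz : z = y'
          · subst hz; simp [Function.update_of_ne h.symm, hf]
          · simp [Function.update_of_ne hz]
        · simp
      right_inv := by
        intro g
        simp }
  have := Fintype.card_congr e
  rw [Fintype.card_prod, Fintype.card_subtype] at this
  rw [← this]
  push_cast
  rfl

lemma min_le_rpow {t s : ℝ} (ht : 0 ≤ t) (hs : 0 < s) (hs1 : s ≤ 1) : min 1 t ≤ t ^ s := by
  rcases le_total 1 t with h | h
  · rw [min_eq_left h]
    exact Real.one_le_rpow h hs.le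
  · rw [min_eq_right h]
    rcases ht.eq_or_lt with h0 | h0
    · rw [← h0, Real.zero_rpow hs.ne']
    · calc t = t ^ (1:ℝ) := (Real.rpow_one t).symm
        _ ≤ t ^ s := Real.rpow_le_rpow_of_exponent_ge h0 h hs1

lemma logb_one_add_le {t s : ℝ} (ht : 0 ≤ t) (hs : 0 < s) (hs1 : s ≤ 1) :
    Real.logb 2 (1 + t) ≤ t ^ s / (s * Real.log 2) := by
  have hl : (0:ℝ) < Real.log 2 := Real.log_pos (by norm_num)
  have h1 : (1 + t) ^ s ≤ 1 + t ^ s := by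
    have := Real.rpow_add_le_add_rpow (p := s) zero_le_one ht hs.le hs1
    simpa using this
  have h2 : s * Real.log (1 + t) ≤ t ^ s := by
    rw [← Real.log_rpow (by linarith)]
    have := Real.log_le_log (by positivity) h1
    have h3 := Real.log_le_sub_one_of_pos (x := 1 + t ^ s) (by positivity)
    linarith
  rw [Real.logb, div_le_div_iff₀ hl (by positivity)]
  nlinarith

/-- The event that the maximum-a-posteriori decoder may fail. -/
def Bad {Ω α β M : Type*} [Fintype Ω] (p : Ω → ℝ) (Y : Ω → α) (X : Ω → β) (f : α → M)
    (ω : Ω) : Prop :=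
  ∃ y', y' ≠ Y ω ∧ f y' = f (Y ω) ∧
    prob p (fun ω => (Y ω, X ω)) (Y ω, X ω) ≤ prob p (fun ω => (Y ω, X ω)) (y', X ω)

lemma exists_dec {Ω α β M : Type*} [Fintype Ω] [Fintype α] [Nonempty α] (p : Ω → ℝ) (Y : Ω → α)
    (X : Ω → β) (f : α → M) :
    ∃ dec : β → M → α, ∀ ω, ¬ Bad p Y X f ω → dec (X ω) (f (Y ω)) = Y ω := by
  have : ∀ (x : β) (m : M), ∃ y : α, (∃ y', f y' = m) → (f y = m ∧ ∀ y', f y' = m →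
      prob p (fun ω => (Y ω, X ω)) (y', x) ≤ prob p (fun ω => (Y ω, X ω)) (y, x)) := by
    intro x m
    by_cases h : ∃ y', f y' = m
    · obtain ⟨y, hy, hy2⟩ := Set.exists_max_image {y | f y = m}
        (fun y => prob p (fun ω => (Y ω, X ω)) (y, x)) (Set.toFinite _) h
      exact ⟨y, fun _ => ⟨hy, hy2⟩⟩
    · exact ⟨Classical.arbitrary α, fun h' => absurd h' h⟩
  choose dec hdec using this
  refine ⟨dec, fun ω hb => ?_⟩
  obtain ⟨h1, h2⟩ := hdec (X ω) (f (Y ω)) ⟨Y ω, rfl⟩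
  by_contra hne
  exact hb ⟨_, hne, h1, h2 _ rfl⟩

lemma err_avg {Ω α β M : Type*} [Fintype Ω] [Fintype α] [Fintype M] [Nonempty M]
    [Fintype (α → M)]
    {p : Ω → ℝ} (hp : IsPMF p) (Y : Ω → α) (X : Ω → β) {s : ℝ} (hs : 0 < s) (hs1 : s ≤ 1) :
    ∑ f : α → M, ∑ ω, (if Bad p Y X f ω then p ω else 0) ≤
      (Fintype.card (α → M) : ℝ) * ∑ ω, p ω * ((Fintype.card M : ℝ)⁻¹ *
        (prob p (fun ω => (Y ω, X ω)) (Y ω, X ω) / prob p X (X ω))⁻¹) ^ s := by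
  have hc : (0:ℝ) < Fintype.card M := by exact_mod_cast Fintype.card_pos
  rw [Finset.sum_comm, Finset.mul_sum]
  refine Finset.sum_le_sum fun ω _ => ?_
  rcases (hp.1 ω).eq_or_lt with h0 | h0
  · simp [← h0]
  have hYX := prob_pos hp (fun ω => (Y ω, X ω)) ω h0
  have hX := prob_pos hp X ω h0
  set P := fun y => prob p (fun ω => (Y ω, X ω)) (y, X ω) with hP
  have e1 : ∑ f : α → M, (if Bad p Y X f ω then p ω else 0) =
      p ω * ∑ f : α → M, (if Bad p Y X f ω then 1 else 0) := by
    rw [Finset.mul_sum]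
    refine Finset.sum_congr rfl fun f _ => by split_ifs <;> simp
  rw [e1, mul_left_comm]
  refine mul_le_mul_of_nonneg_left ?_ h0.le
  refine le_trans ?_ (mul_le_mul_of_nonneg_left (min_le_rpow (by positivity) hs hs1) (by positivity))
  rw [mul_min_of_nonneg _ _ (by positivity), le_min_iff]
  constructor
  · calc _ ≤ ∑ f : α → M, (1:ℝ) := Finset.sum_le_sum fun f _ => by split_ifs <;> simp
      _ = _ := by simp
  · have b1 : ∀ f : α → M, (if Bad p Y X f ω then (1:ℝ) else 0) ≤
        ∑ y', if y' ≠ Y ω ∧ P (Y ω) ≤ P y' then (if f y' = f (Y ω) then (1:ℝ) else 0) else 0 := by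
      intro f
      have hnn : ∀ y', (0:ℝ) ≤
        if y' ≠ Y ω ∧ P (Y ω) ≤ P y' then (if f y' = f (Y ω) then (1:ℝ) else 0) else 0 := by
        intro y'; split_ifs <;> simp
      split_ifs with hb
      · obtain ⟨y', h1, h2, h3⟩ := hb
        refine le_trans ?_ (Finset.single_le_sum (fun y' _ => hnn y') (Finset.mem_univ y'))
        rw [if_pos ⟨h1, h3⟩, if_pos h2]
      · exact Finset.sum_nonneg fun y' _ => hnn y'
    refine (Finset.sum_le_sum fun f _ => b1 f).trans ?_
    rw [Finset.sum_comm]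
    have b2 : ∀ y', ∑ f : α → M,
        (if y' ≠ Y ω ∧ P (Y ω) ≤ P y' then (if f y' = f (Y ω) then (1:ℝ) else 0) else 0) ≤
        (Fintype.card (α → M) : ℝ) * (Fintype.card M : ℝ)⁻¹ * (P y' / P (Y ω)) := by
      intro y'
      have hPy : 0 ≤ P y' := prob_nonneg hp _ _
      by_cases h : y' ≠ Y ω ∧ P (Y ω) ≤ P y'
      · simp only [h, if_true, and_self, ne_eq, not_false_eq_true]
        rw [collision h.1]
        refine le_mul_of_one_le_right (by positivity) ?_
        rw [one_le_div hYX]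
        exact h.2
      · simp only [h, if_false, Finset.sum_const_zero]
        positivity
    refine (Finset.sum_le_sum fun y' _ => b2 y').trans ?_
    rw [← Finset.mul_sum, ← Finset.sum_div, sum_prob_pair, inv_div, mul_assoc]

lemma prob_hash {Ω α β γ : Type*} [Fintype Ω] [Fintype α] (p : Ω → ℝ) (Y : Ω → α) (X : Ω → β)
    (h : α → γ) (c : γ) (x : β) :
    prob p (fun ω => (h (Y ω), X ω)) (c, x) =
      ∑ y', if h y' = c then prob p (fun ω => (Y ω, X ω)) (y', x) else 0 := by
  have this : ∀ y', (if h y' = c then prob p (fun ω => (Y ω, X ω)) (y', x) else 0) =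
      ∑ ω, if h y' = c then (if (Y ω, X ω) = (y', x) then p ω else 0) else 0 := by
    intro y'; split_ifs <;> simp [prob]
  rw [Finset.sum_congr rfl (fun y' _ => this y'), prob]
  rw [Finset.sum_comm]
  refine Finset.sum_congr rfl fun ω _ => ?_
  rw [Finset.sum_eq_single (Y ω)]
  · simp only [Prod.mk.injEq, true_and]
    by_cases h1 : h (Y ω) = c <;> simp [h1]
  · intro b _ hb
    simp [Ne.symm hb]
  · simp

lemma ent_pair_le {Ω A B : Type*} [Fintype Ω] [Fintype A] [Fintype B] {p : Ω → ℝ}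
    (hp : IsPMF p) (X : Ω → A) (Y : Ω → B) :
    ent p (fun ω => (X ω, Y ω)) ≤ ent p X + ent p Y := by
  refine (gibbs hp (fun ω => (X ω, Y ω)) (fun t => prob p X t.1 * prob p Y t.2)
    (fun t => mul_nonneg (prob_nonneg hp _ _) (prob_nonneg hp _ _)) ?_ ?_).trans ?_
  · rw [Fintype.sum_prod_type]
    simp only [← Finset.mul_sum, sum_prob hp, mul_one, le_refl]
  · intro ω h0
    exact mul_pos (prob_pos hp X ω h0) (prob_pos hp Y ω h0)
  · rw [ent_eq, ent_eq, ← neg_add, ← Finset.sum_add_distrib, neg_le_neg_iff]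
    refine Finset.sum_le_sum fun ω _ => ?_
    rcases (hp.1 ω).eq_or_lt with h0 | h0
    · simp [← h0]
    · simp only
      rw [Real.logb_mul (prob_pos hp X ω h0).ne' (prob_pos hp Y ω h0).ne', mul_add]

/-- Divergence from perfect secrecy and uniformity. -/
def secDef {Ω α β M S : Type*} [Fintype Ω] [Fintype β] [Fintype M] [Fintype S]
    (p : Ω → ℝ) (Y : Ω → α) (X : Ω → β) (f : α → M) (g : α → S) : ℝ :=
  Real.logb 2 (Fintype.card S) + Real.logb 2 (Fintype.card M) + ent p X -
    ent p (fun ω => (g (Y ω), f (Y ω), X ω))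

lemma sec_avg {Ω α β M S : Type*} [Fintype Ω] [Fintype α] [Fintype β] [Fintype M] [Nonempty M]
    [Fintype S] [Nonempty S] [Fintype (α → M)] [Fintype (α → S)]
    {p : Ω → ℝ} (hp : IsPMF p) (Y : Ω → α) (X : Ω → β) {s : ℝ} (hs : 0 < s) (hs1 : s ≤ 1) :
    ∑ f : α → M, ∑ g : α → S, secDef p Y X f g ≤
      (Fintype.card (α → M) : ℝ) * Fintype.card (α → S) * ((s * Real.log 2)⁻¹ *
        ∑ ω, p ω * ((Fintype.card S * Fintype.card M : ℝ) *
          (prob p (fun ω => (Y ω, X ω)) (Y ω, X ω) / prob p X (X ω))) ^ s) := by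
  have hl : (0:ℝ) < Real.log 2 := Real.log_pos (by norm_num)
  have hM : (0:ℝ) < Fintype.card M := by exact_mod_cast Fintype.card_pos
  have hS : (0:ℝ) < Fintype.card S := by exact_mod_cast Fintype.card_pos
  set K : ℝ := Fintype.card S * Fintype.card M with hK
  have hK0 : 0 < K := mul_pos hS hM
  have e1 : ∀ (f : α → M) (g : α → S), secDef p Y X f g = ∑ ω, p ω *
      Real.logb 2 (K * (prob p (fun ω => (g (Y ω), f (Y ω), X ω)) (g (Y ω), f (Y ω), X ω) /
        prob p X (X ω))) := by
    intro f g
    rw [secDef, ent_eq, ent_eq, ← Real.logb_mul hS.ne' hM.ne', ← hK, sub_neg_eq_add]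
    have : Real.logb 2 K = ∑ ω, p ω * Real.logb 2 K := by rw [← Finset.sum_mul, hp.2, one_mul]
    rw [this, ← Finset.sum_neg_distrib, ← Finset.sum_add_distrib, ← Finset.sum_add_distrib]
    refine Finset.sum_congr rfl fun ω _ => ?_
    rcases (hp.1 ω).eq_or_lt with h0 | h0
    · simp [← h0]
    · have h1 := prob_pos hp (fun ω => (g (Y ω), f (Y ω), X ω)) ω h0
      have h2 := prob_pos hp X ω h0
      rw [Real.logb_mul hK0.ne' (div_pos h1 h2).ne', Real.logb_div h1.ne' h2.ne']
      ring
  simp only [e1]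
  have e2 : ∑ f : α → M, ∑ g : α → S, ∑ ω, p ω *
      Real.logb 2 (K * (prob p (fun ω => (g (Y ω), f (Y ω), X ω)) (g (Y ω), f (Y ω), X ω) /
        prob p X (X ω))) = ∑ ω, p ω * ∑ f : α → M, ∑ g : α → S, 
      Real.logb 2 (K * (prob p (fun ω => (g (Y ω), f (Y ω), X ω)) (g (Y ω), f (Y ω), X ω) /
        prob p X (X ω))) := by
    simp only [Finset.mul_sum]
    rw [Finset.sum_comm]
    conv_rhs => rw [Finset.sum_comm]
    rw [Finset.sum_comm]
    refine Finset.sum_congr rfl fun f _ => ?_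
    rw [Finset.sum_comm]
  rw [e2, Finset.mul_sum, Finset.mul_sum]
  refine Finset.sum_le_sum fun ω _ => ?_
  rcases (hp.1 ω).eq_or_lt with h0 | h0
  · simp [← h0]
  have hYX := prob_pos hp (fun ω => (Y ω, X ω)) ω h0
  have hX := prob_pos hp X ω h0
  set P := fun y => prob p (fun ω => (Y ω, X ω)) (y, X ω) with hP
  set x := prob p X (X ω) with hx
  have hPY : prob p (fun ω => (Y ω, X ω)) (Y ω, X ω) = P (Y ω) := rfl
  rw [hPY] at hYX ⊢
  set N : ℝ := (Fintype.card (α → M) : ℝ) * Fintype.card (α → S) with hN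
  have hN0 : 0 ≤ N := by positivity
  set c : ℝ := 1 + K * (P (Y ω) / x) with hc
  have hc0 : 0 < c := by positivity
  have hclog := logb_one_add_le (t := K * (P (Y ω) / x)) (by positivity) hs hs1
  rw [← hc] at hclog
  have e3 : ∀ (f : α → M) (g : α → S),
      prob p (fun ω => (g (Y ω), f (Y ω), X ω)) (g (Y ω), f (Y ω), X ω) =
      ∑ y', (if f y' = f (Y ω) then (1:ℝ) else 0) * (if g y' = g (Y ω) then (1:ℝ) else 0) *
        P y' := by
    intro f g
    have h1 := prob_hash p Y X (fun y => (g y, f y)) (g (Y ω), f (Y ω)) (X ω)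
    have h2 : prob p (fun ω => (g (Y ω), f (Y ω), X ω)) (g (Y ω), f (Y ω), X ω) =
      prob p (fun ω => ((g (Y ω), f (Y ω)), X ω)) ((g (Y ω), f (Y ω)), X ω) := by
      simp only [prob, Prod.mk.injEq, and_assoc]
    rw [h2, h1]
    refine Finset.sum_congr rfl fun y' _ => ?_
    by_cases a1 : f y' = f (Y ω) <;> by_cases a2 : g y' = g (Y ω) <;> simp [a1, a2, hP]
  have e4 : ∑ f : α → M, ∑ g : α → S,
      prob p (fun ω => (g (Y ω), f (Y ω), X ω)) (g (Y ω), f (Y ω), X ω) ≤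
      N * (P (Y ω) + x / K) := by
    have h1 : ∀ y', ∑ f : α → M, ∑ g : α → S, (if f y' = f (Y ω) then (1:ℝ) else 0) *
        (if g y' = g (Y ω) then (1:ℝ) else 0) * P y' ≤
        N * ((if y' = Y ω then P (Y ω) else 0) + P y' / K) := by
      intro y'
      have hPy : 0 ≤ P y' := prob_nonneg hp _ _
      by_cases h : y' = Y ω
      · subst h
        simp only [if_true, one_mul, Finset.sum_const, Finset.card_univ, nsmul_eq_mul]
        rw [← mul_assoc, ← hN]
        refine mul_le_mul_of_nonneg_left ?_ hN0
        have : 0 ≤ P (Y ω) / K := by positivity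
        linarith
      · simp only [← Finset.sum_mul, ← Finset.mul_sum]
        rw [collision h, collision h, if_neg h, zero_add]
        apply le_of_eq
        rw [hN, hK]
        field_simp
    simp only [e3]
    have h2 : ∑ f : α → M, ∑ g : α → S, ∑ y', (if f y' = f (Y ω) then (1:ℝ) else 0) *
        (if g y' = g (Y ω) then (1:ℝ) else 0) * P y' = ∑ y', ∑ f : α → M, ∑ g : α → S,
        (if f y' = f (Y ω) then (1:ℝ) else 0) *
        (if g y' = g (Y ω) then (1:ℝ) else 0) * P y' := by
      conv_rhs => rw [Finset.sum_comm]
      refine Finset.sum_congr rfl fun f _ => ?_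
      rw [Finset.sum_comm]
    rw [h2]
    refine (Finset.sum_le_sum fun y' _ => h1 y').trans ?_
    rw [← Finset.mul_sum, Finset.sum_add_distrib, ← Finset.sum_div, sum_prob_pair]
    simp
    rfl
  have e5 : ∀ (f : α → M) (g : α → S), Real.logb 2 (K *
      (prob p (fun ω => (g (Y ω), f (Y ω), X ω)) (g (Y ω), f (Y ω), X ω) / x)) ≤
      Real.logb 2 c - 1 / Real.log 2 + (K / x / c / Real.log 2) *
        prob p (fun ω => (g (Y ω), f (Y ω), X ω)) (g (Y ω), f (Y ω), X ω) := by
    intro f g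
    have h1 := prob_pos hp (fun ω => (g (Y ω), f (Y ω), X ω)) ω h0
    set q := prob p (fun ω => (g (Y ω), f (Y ω), X ω)) (g (Y ω), f (Y ω), X ω) with hq
    have hZ : 0 < K * (q / x) := by positivity
    have h3 := Real.log_le_sub_one_of_pos (div_pos hZ hc0)
    rw [Real.log_div hZ.ne' hc0.ne'] at h3
    have : Real.logb 2 c - 1 / Real.log 2 + (K / x / c / Real.log 2) * q =
      (Real.log c + (K * (q / x) / c - 1)) / Real.log 2 := by
      rw [Real.logb]; field_simp; ring
    rw [this, Real.logb]
    gcongr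
    linarith
  rw [mul_left_comm _ (p ω), mul_left_comm N (p ω)]
  refine mul_le_mul_of_nonneg_left ?_ h0.le
  have e6 : ∑ f : α → M, ∑ g : α → S, Real.logb 2 (K *
      (prob p (fun ω => (g (Y ω), f (Y ω), X ω)) (g (Y ω), f (Y ω), X ω) / x)) ≤
      N * (Real.logb 2 c - 1 / Real.log 2) + (K / x / c / Real.log 2) * (N * (P (Y ω) + x / K)) := by
    refine (Finset.sum_le_sum fun f _ => Finset.sum_le_sum fun g _ => e5 f g).trans ?_
    simp only [Finset.sum_add_distrib, ← Finset.mul_sum, Finset.sum_const, Finset.card_univ,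
      nsmul_eq_mul]
    rw [← mul_assoc, mul_comm (Fintype.card (α → S) : ℝ), ← hN]
    gcongr
  refine e6.trans ?_
  have e7 : N * (Real.logb 2 c - 1 / Real.log 2) +
      (K / x / c / Real.log 2) * (N * (P (Y ω) + x / K)) = N * Real.logb 2 c := by
    have : (K / x / c / Real.log 2) * (N * (P (Y ω) + x / K)) = N * (1 / Real.log 2) := by
      have h5 : P (Y ω) + x / K = x / K * c := by rw [hc]; field_simp; ring
      rw [h5]; field_simp
    rw [this]; ring
  rw [e7]
  refine mul_le_mul_of_nonneg_left ?_ hN0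
  rw [inv_mul_eq_div]
  exact hclog

/-! ### Chernoff bound -/

lemma chern {Ω : Type*} [Fintype Ω] {p : Ω → ℝ} (hp : IsPMF p) (w : Ω → ℝ)
    (hw : ∀ ω, 0 < p ω → 0 < w ω) (hneg : ∑ ω, p ω * Real.log (w ω) < 0) :
    ∃ s : ℝ, 0 < s ∧ s ≤ 1 ∧ ∑ ω, p ω * w ω ^ s < 1 := by
  have hd : HasDerivAt (fun s : ℝ => ∑ ω, p ω * Real.exp (s * Real.log (w ω)))
      (∑ ω, p ω * Real.log (w ω)) 0 := by
    refine HasDerivAt.fun_sum fun ω _ => ?_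
    have h1 : HasDerivAt (fun s : ℝ => s * Real.log (w ω)) (1 * Real.log (w ω)) 0 :=
      (hasDerivAt_id (0:ℝ)).mul_const _
    have h2 := (h1.exp).const_mul (p ω)
    simpa using h2
  have hs := hasDerivAt_iff_tendsto_slope.mp hd
  have h1 : ∀ᶠ s in nhdsWithin (0:ℝ) (Set.Ioi 0),
      slope (fun s : ℝ => ∑ ω, p ω * Real.exp (s * Real.log (w ω))) 0 s < 0 := by
    have := hs.eventually (gt_mem_nhds hneg)
    refine this.filter_mono (nhdsWithin_mono (0:ℝ) ?_)
    intro x hx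
    exact ne_of_gt hx
  have h2 : ∀ᶠ s in nhdsWithin (0:ℝ) (Set.Ioi 0), s ∈ Set.Ioc (0:ℝ) 1 :=
    Ioc_mem_nhdsGT (by norm_num)
  obtain ⟨s, hs1, hs2⟩ := (h1.and h2).exists
  refine ⟨s, hs2.1, hs2.2, ?_⟩
  rw [slope_def_field, div_neg_iff] at hs1
  have hs3 : ∑ ω, p ω * Real.exp (s * Real.log (w ω)) < 1 := by
    rcases hs1 with ⟨_, h⟩ | ⟨h, _⟩
    · have := hs2.1
      linarith
    · simp only [zero_mul, Real.exp_zero, mul_one, hp.2] at h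
      linarith
  refine lt_of_le_of_lt (le_of_eq ?_) hs3
  refine Finset.sum_congr rfl fun ω _ => ?_
  rcases (hp.1 ω).eq_or_lt with h0 | h0
  · simp [← h0]
  · rw [Real.rpow_def_of_pos (hw ω h0), mul_comm (Real.log _)]

lemma chern_pi {Ω : Type*} [Fintype Ω] {p : Ω → ℝ} (hp : IsPMF p) (v : Ω → ℝ) (a : ℝ)
    (hv0 : ∀ ω, 0 ≤ v ω)
    (hv : ∀ ω, 0 < p ω → 0 < v ω) (hneg : ∑ ω, p ω * Real.logb 2 (v ω) + a < 0) :
    ∃ s θ : ℝ, 0 < s ∧ s ≤ 1 ∧ 0 ≤ θ ∧ θ < 1 ∧ ∀ (n : ℕ) (C : ℝ), 0 ≤ C →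
      C ≤ 4 * 2 ^ ((n:ℝ) * a) →
      ∑ ω : Fin n → Ω, (∏ i, p (ω i)) * (C * ∏ i, v (ω i)) ^ s ≤ 4 * θ ^ n := by
  have hl : (0:ℝ) < Real.log 2 := Real.log_pos (by norm_num)
  obtain ⟨s, hs, hs1, hlt⟩ := chern hp (fun ω => (2:ℝ) ^ a * v ω)
    (fun ω h => mul_pos (by positivity) (hv ω h)) (by
      have : ∑ ω, p ω * Real.log ((2:ℝ) ^ a * v ω) =
          Real.log 2 * (∑ ω, p ω * Real.logb 2 (v ω) + a) := by
        have h1 : a = ∑ ω, p ω * a := by rw [← Finset.sum_mul, hp.2, one_mul]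
        conv_rhs => rw [h1]
        rw [← Finset.sum_add_distrib, Finset.mul_sum]
        refine Finset.sum_congr rfl fun ω _ => ?_
        rcases (hp.1 ω).eq_or_lt with h0 | h0
        · simp [← h0]
        · rw [Real.log_mul (by positivity) (hv ω h0).ne', Real.log_rpow (by norm_num), Real.logb]
          field_simp
          ring
      rw [this]
      exact mul_neg_of_pos_of_neg hl hneg)
  refine ⟨s, _, hs, hs1, ?_, hlt, ?_⟩
  · exact Finset.sum_nonneg fun ω _ => mul_nonneg (hp.1 ω)
      (Real.rpow_nonneg (mul_nonneg (by positivity) (hv0 ω)) _)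
  · intro n C hC0 hC
    have h1 : (∑ ω, p ω * ((2:ℝ) ^ a * v ω) ^ s) ^ n =
        ∑ ω : Fin n → Ω, ∏ i, (p (ω i) * ((2:ℝ) ^ a * v (ω i)) ^ s) := by
      rw [sum_prod_pi n (fun _ ω => p ω * ((2:ℝ) ^ a * v ω) ^ s)]
      simp
    rw [h1, Finset.mul_sum]
    refine Finset.sum_le_sum fun ω _ => ?_
    rw [Finset.prod_mul_distrib, mul_left_comm]
    refine mul_le_mul_of_nonneg_left ?_ (Finset.prod_nonneg fun i _ => hp.1 _)
    have hpv : 0 ≤ ∏ i, v (ω i) := Finset.prod_nonneg fun i _ => hv0 _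
    rw [Real.finsetProd_rpow _ _ (fun i _ => mul_nonneg (by positivity) (hv0 _)),
      Finset.prod_mul_distrib]
    have h2 : ∏ _i : Fin n, (2:ℝ) ^ a = 2 ^ ((n:ℝ) * a) := by
      rw [Finset.prod_const, Finset.card_univ, Fintype.card_fin, mul_comm, Real.rpow_mul (by norm_num),
        Real.rpow_natCast]
    rw [h2]
    calc (C * ∏ i, v (ω i)) ^ s ≤ (4 * ((2:ℝ) ^ ((n:ℝ) * a) * ∏ i, v (ω i))) ^ s := by
          refine Real.rpow_le_rpow (by positivity) ?_ hs.le
          rw [← mul_assoc]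
          exact mul_le_mul_of_nonneg_right hC hpv
      _ = (4:ℝ) ^ s * ((2:ℝ) ^ ((n:ℝ) * a) * ∏ i, v (ω i)) ^ s :=
          Real.mul_rpow (by norm_num) (by positivity)
      _ ≤ 4 * _ := by
          refine mul_le_mul_of_nonneg_right ?_ (by positivity)
          calc (4:ℝ) ^ s ≤ 4 ^ (1:ℝ) := Real.rpow_le_rpow_of_exponent_le (by norm_num) hs1
            _ = 4 := Real.rpow_one 4

/-! ### Achievability -/

/-- Block of dealer observations. -/
def Yn {L : ℕ} (𝒳 : Fin L → Type) (𝒴 : Fin 1 → Type) (n : ℕ) :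
    (Fin n → Base 𝒳 𝒴) → (Fin n → 𝒴 0) := fun ω i => (ω i).2 0

/-- The single-letter posterior. -/
def post {L : ℕ} {𝒳 : Fin L → Type} {𝒴 : Fin 1 → Type}
    [∀ l, Fintype (𝒳 l)] [∀ d, Fintype (𝒴 d)]
    (p : Base 𝒳 𝒴 → ℝ) (T : Finset (Fin L)) (ω : Base 𝒳 𝒴) : ℝ :=
  prob p (fun ω => (ω.2 0, XT T ω)) (ω.2 0, XT T ω) / prob p (XT T) (XT T ω)

lemma post_n {L : ℕ} {𝒳 : Fin L → Type} {𝒴 : Fin 1 → Type}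
    [∀ l, Fintype (𝒳 l)] [∀ d, Fintype (𝒴 d)]
    (p : Base 𝒳 𝒴 → ℝ) (T : Finset (Fin L)) (n : ℕ) (ω : Fin n → Base 𝒳 𝒴) :
    prob (iid p n) (fun ω => (Yn 𝒳 𝒴 n ω, XTn T n ω)) (Yn 𝒳 𝒴 n ω, XTn T n ω) /
      prob (iid p n) (XTn T n) (XTn T n ω) = ∏ i, post p T (ω i) := by
  have hX : ∀ (ω ω' : Fin n → Base 𝒳 𝒴),
      XTn T n ω' = XTn T n ω ↔ ∀ i, XT T (ω' i) = XT T (ω i) := by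
    intro ω ω'
    constructor
    · intro h i
      funext l
      exact congrFun (congrFun h l) i
    · intro h
      funext l i
      exact congrFun (h i) l
  have hYi : ∀ (ω ω' : Fin n → Base 𝒳 𝒴), Yn 𝒳 𝒴 n ω' = Yn 𝒳 𝒴 n ω ↔
      ∀ i, (ω' i).2 0 = (ω i).2 0 := fun ω ω' => funext_iff
  simp only [post]
  rw [Finset.prod_div_distrib]
  congr 1
  · rw [← prob_pi p n (fun ω => (ω.2 0, XT T ω)) (fun i => ((ω i).2 0, XT T (ω i)))]
    refine prob_congr (iid p n) (fun ω => (Yn 𝒳 𝒴 n ω, XTn T n ω))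
      (fun ω i => ((ω i).2 0, XT T (ω i))) ω fun ω' => ?_
    simp only [Prod.mk.injEq, hX, hYi, funext_iff (f := fun i => (_, _)), forall_and]
  · rw [← prob_pi p n (XT T) (fun i => XT T (ω i))]
    refine prob_congr (iid p n) (XTn T n) (fun ω i => XT T (ω i)) ω fun ω' => ?_
    rw [hX, funext_iff]

/-- Single-letter conditional entropy of the dealer's source given `X_T`. -/
def hT {L : ℕ} {𝒳 : Fin L → Type} {𝒴 : Fin 1 → Type}
    [∀ l, Fintype (𝒳 l)] [∀ d, Fintype (𝒴 d)]
    (p : Base 𝒳 𝒴 → ℝ) (T : Finset (Fin L)) : ℝ :=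
  ent p (fun ω => (ω.2 0, XT T ω)) - ent p (XT T)

lemma sum_log_post {L : ℕ} {𝒳 : Fin L → Type} {𝒴 : Fin 1 → Type}
    [∀ l, Fintype (𝒳 l)] [∀ d, Fintype (𝒴 d)]
    {p : Base 𝒳 𝒴 → ℝ} (hp : IsPMF p) (T : Finset (Fin L)) :
    ∑ ω, p ω * Real.logb 2 (post p T ω) = - hT p T := by
  rw [hT, ent_eq, ent_eq, neg_sub, sub_neg_eq_add, neg_add_eq_sub, ← Finset.sum_sub_distrib]
  refine Finset.sum_congr rfl fun ω _ => ?_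
  rcases (hp.1 ω).eq_or_lt with h0 | h0
  · simp [← h0]
  · rw [post, Real.logb_div (prob_pos hp (fun ω => (ω.2 0, XT T ω)) ω h0).ne'
      (prob_pos hp (XT T) ω h0).ne', mul_sub]

lemma post_nonneg {L : ℕ} {𝒳 : Fin L → Type} {𝒴 : Fin 1 → Type}
    [∀ l, Fintype (𝒳 l)] [∀ d, Fintype (𝒴 d)]
    {p : Base 𝒳 𝒴 → ℝ} (hp : IsPMF p) (T : Finset (Fin L)) (ω : Base 𝒳 𝒴) : 0 ≤ post p T ω :=
  div_nonneg (prob_nonneg hp _ _) (prob_nonneg hp _ _)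

lemma post_pos {L : ℕ} {𝒳 : Fin L → Type} {𝒴 : Fin 1 → Type}
    [∀ l, Fintype (𝒳 l)] [∀ d, Fintype (𝒴 d)]
    {p : Base 𝒳 𝒴 → ℝ} (hp : IsPMF p) (T : Finset (Fin L)) (ω : Base 𝒳 𝒴) (h0 : 0 < p ω) :
    0 < post p T ω :=
  div_pos (prob_pos hp (fun ω => (ω.2 0, XT T ω)) ω h0) (prob_pos hp (XT T) ω h0)

lemma ceil_le (n : ℕ) {a : ℝ} (ha : 0 ≤ a) :
    ((⌈(2:ℝ) ^ ((n:ℝ) * a)⌉₊ : ℕ) : ℝ) ≤ 2 * 2 ^ ((n:ℝ) * a) := by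
  have h2 : (1:ℝ) ≤ 2 ^ ((n:ℝ) * a) := Real.one_le_rpow (by norm_num) (by positivity)
  have := (Nat.ceil_lt_add_one (by positivity : (0:ℝ) ≤ 2 ^ ((n:ℝ) * a))).le
  linarith

lemma ceil_pos' (n : ℕ) (a : ℝ) : 0 < ⌈(2:ℝ) ^ ((n:ℝ) * a)⌉₊ :=
  Nat.ceil_pos.mpr (by positivity)

/-- Cost of a pair of binnings for the set `T`: error bound if authorized, secrecy defect if not. -/
def cost {L : ℕ} {𝒳 : Fin L → Type} {𝒴 : Fin 1 → Type}
    [∀ l, Fintype (𝒳 l)] [∀ d, Fintype (𝒴 d)]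
    (p : Base 𝒳 𝒴 → ℝ) (𝔸 : Set (Finset (Fin L))) (T : Finset (Fin L)) (n : ℕ)
    {M S : Type} [Fintype M] [Fintype S] (f : (Fin n → 𝒴 0) → M) (g : (Fin n → 𝒴 0) → S) : ℝ :=
  if T ∈ 𝔸 then ∑ ω, (if Bad (iid p n) (Yn 𝒳 𝒴 n) (XTn T n) f ω then iid p n ω else 0)
  else secDef (iid p n) (Yn 𝒳 𝒴 n) (XTn T n) f g

lemma cost_avg {L : ℕ} {𝒳 : Fin L → Type} {𝒴 : Fin 1 → Type}
    [∀ l, Fintype (𝒳 l)] [∀ d, Fintype (𝒴 d)]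
    {p : Base 𝒳 𝒴 → ℝ} (hp : IsPMF p) (𝔸 : Set (Finset (Fin L))) (T : Finset (Fin L))
    {R RM : ℝ} (hR : 0 ≤ R) (hRM : 0 ≤ RM) (hA : T ∈ 𝔸 → hT p T < RM)
    (hU : T ∉ 𝔸 → RM + R < hT p T) :
    ∃ c θ : ℝ, 0 ≤ θ ∧ θ < 1 ∧ ∀ n : ℕ,
      ∑ f : (Fin n → 𝒴 0) → Fin ⌈(2:ℝ) ^ ((n:ℝ) * RM)⌉₊,
      ∑ g : (Fin n → 𝒴 0) → Fin ⌈(2:ℝ) ^ ((n:ℝ) * R)⌉₊, cost p 𝔸 T n f g ≤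
      (Fintype.card ((Fin n → 𝒴 0) → Fin ⌈(2:ℝ) ^ ((n:ℝ) * RM)⌉₊) : ℝ) *
      Fintype.card ((Fin n → 𝒴 0) → Fin ⌈(2:ℝ) ^ ((n:ℝ) * R)⌉₊) * (c * θ ^ n) := by
  by_cases hT' : T ∈ 𝔸
  · obtain ⟨s, θ, hs, hs1, hθ, hθ1, hb⟩ := chern_pi hp (fun ω => (post p T ω)⁻¹) (-RM)
      (fun ω => inv_nonneg.mpr (post_nonneg hp T ω)) (fun ω h => inv_pos.mpr (post_pos hp T ω h)) (by
        simp only [Real.logb_inv, mul_neg, Finset.sum_neg_distrib, sum_log_post hp]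
        have := hA hT'
        linarith)
    refine ⟨4, θ, hθ, hθ1, fun n => ?_⟩
    have : Nonempty (Fin ⌈(2:ℝ) ^ ((n:ℝ) * RM)⌉₊) := ⟨⟨0, ceil_pos' n RM⟩⟩
    simp only [cost, hT', if_true, Finset.sum_const, Finset.card_univ, nsmul_eq_mul]
    rw [← Finset.mul_sum, mul_comm (Fintype.card (_ → Fin ⌈(2:ℝ) ^ ((n:ℝ) * RM)⌉₊) : ℝ), mul_assoc]
    refine mul_le_mul_of_nonneg_left ?_ (by positivity)
    refine (err_avg (p := iid p n) (isPMF_pi hp n) (Yn 𝒳 𝒴 n) (XTn T n) hs hs1).trans ?_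
    refine mul_le_mul_of_nonneg_left ?_ (by positivity)
    refine le_trans (le_of_eq ?_) (hb n ((⌈(2:ℝ) ^ ((n:ℝ) * RM)⌉₊ : ℕ) : ℝ)⁻¹ (by positivity) ?_)
    · refine Finset.sum_congr rfl fun ω _ => ?_
      rw [post_n, Finset.prod_inv_distrib, Fintype.card_fin]
      rfl
    · rw [mul_neg, Real.rpow_neg (by norm_num)]
      have h1 : (0:ℝ) < 2 ^ ((n:ℝ) * RM) := by positivity
      have h2 : ((⌈(2:ℝ) ^ ((n:ℝ) * RM)⌉₊ : ℕ) : ℝ)⁻¹ ≤ ((2:ℝ) ^ ((n:ℝ) * RM))⁻¹ :=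
        inv_anti₀ h1 (Nat.le_ceil _)
      have h3 : 0 < ((2:ℝ) ^ ((n:ℝ) * RM))⁻¹ := by positivity
      linarith
  · obtain ⟨s, θ, hs, hs1, hθ, hθ1, hb⟩ := chern_pi hp (fun ω => post p T ω) (RM + R)
      (fun ω => post_nonneg hp T ω) (fun ω h => post_pos hp T ω h) (by
        rw [sum_log_post hp]
        have := hU hT'
        linarith)
    refine ⟨(s * Real.log 2)⁻¹ * 4, θ, hθ, hθ1, fun n => ?_⟩
    have : Nonempty (Fin ⌈(2:ℝ) ^ ((n:ℝ) * RM)⌉₊) := ⟨⟨0, ceil_pos' n RM⟩⟩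
    have : Nonempty (Fin ⌈(2:ℝ) ^ ((n:ℝ) * R)⌉₊) := ⟨⟨0, ceil_pos' n R⟩⟩
    have hl : (0:ℝ) < Real.log 2 := Real.log_pos (by norm_num)
    simp only [cost, hT', if_false]
    refine (sec_avg (p := iid p n) (isPMF_pi hp n) (Yn 𝒳 𝒴 n) (XTn T n) hs hs1).trans ?_
    refine mul_le_mul_of_nonneg_left ?_ (by positivity)
    rw [mul_assoc]
    refine mul_le_mul_of_nonneg_left ?_ (by positivity)
    refine le_trans (le_of_eq ?_) (hb n (((⌈(2:ℝ) ^ ((n:ℝ) * R)⌉₊ : ℕ) : ℝ) *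
      ((⌈(2:ℝ) ^ ((n:ℝ) * RM)⌉₊ : ℕ) : ℝ)) (by positivity) ?_)
    · refine Finset.sum_congr rfl fun ω _ => ?_
      rw [post_n, Fintype.card_fin, Fintype.card_fin]
      rfl
    · rw [mul_add, Real.rpow_add (by norm_num)]
      calc _ ≤ (2 * (2:ℝ) ^ ((n:ℝ) * R)) * (2 * 2 ^ ((n:ℝ) * RM)) :=
            mul_le_mul (ceil_le n hR) (ceil_le n hRM) (by positivity) (by positivity)
        _ = _ := by ring

lemma leak_nonneg {L : ℕ} {𝒳 : Fin L → Type} {𝒴 : Fin 1 → Type}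
    [∀ l, Fintype (𝒳 l)] [∀ d, Fintype (𝒴 d)]
    {p : Base 𝒳 𝒴 → ℝ} (hp : IsPMF p) {𝔸 : Set (Finset (Fin L))} {R : Fin 1 → ℝ} {n : ℕ}
    (σ : Strategy 𝒳 𝒴 𝔸 R n) (U : Finset (Fin L)) : 0 ≤ σ.leak p U := by
  have := ent_pair_le (p := iid p n) (isPMF_pi hp n) σ.Srv (fun ω => (σ.Mrv ω, XTn U n ω))
  simp only [Strategy.leak, mutInf]
  linarith

lemma unif_nonneg {L : ℕ} {𝒳 : Fin L → Type} {𝒴 : Fin 1 → Type}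
    [∀ l, Fintype (𝒳 l)] [∀ d, Fintype (𝒴 d)]
    {p : Base 𝒳 𝒴 → ℝ} (hp : IsPMF p) {𝔸 : Set (Finset (Fin L))} {R : Fin 1 → ℝ} {n : ℕ}
    (σ : Strategy 𝒳 𝒴 𝔸 R n) : 0 ≤ σ.unif p := by
  have := ent_le_log (p := iid p n) (isPMF_pi hp n) σ.Srv
  simp only [Fintype.card_pi, Fintype.card_fin, Nat.cast_prod] at this
  simp only [Strategy.unif]
  linarith

lemma secDef_nonneg {Ω α β M S : Type*} [Fintype Ω] [Fintype β] [Fintype M] [Fintype S]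
    {p : Ω → ℝ} (hp : IsPMF p) (Y : Ω → α) (X : Ω → β) (f : α → M) (g : α → S) :
    0 ≤ secDef p Y X f g := by
  have h1 := ent_pair_le hp (fun ω => g (Y ω)) (fun ω => (f (Y ω), X ω))
  have h2 := ent_pair_le hp (fun ω => f (Y ω)) X
  have h3 := ent_le_log hp (fun ω => g (Y ω))
  have h4 := ent_le_log hp (fun ω => f (Y ω))
  simp only [secDef]
  linarith

lemma cost_nonneg {L : ℕ} {𝒳 : Fin L → Type} {𝒴 : Fin 1 → Type}
    [∀ l, Fintype (𝒳 l)] [∀ d, Fintype (𝒴 d)]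
    {p : Base 𝒳 𝒴 → ℝ} (hp : IsPMF p) (𝔸 : Set (Finset (Fin L))) (T : Finset (Fin L)) (n : ℕ)
    {M S : Type} [Fintype M] [Fintype S] (f : (Fin n → 𝒴 0) → M) (g : (Fin n → 𝒴 0) → S) :
    0 ≤ cost p 𝔸 T n f g := by
  have hq : IsPMF (iid p n) := isPMF_pi hp n
  unfold cost
  split_ifs
  · exact Finset.sum_nonneg fun ω _ => by split_ifs <;> simp [hq.1 ω]
  · exact secDef_nonneg hq _ _ _ _

lemma exists_strategy {L : ℕ} {𝒳 : Fin L → Type} {𝒴 : Fin 1 → Type}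
    [∀ l, Fintype (𝒳 l)] [∀ d, Fintype (𝒴 d)] [∀ d, Nonempty (𝒴 d)]
    {p : Base 𝒳 𝒴 → ℝ} (hp : IsPMF p) (𝔸 : Set (Finset (Fin L))) (ρ : ℝ) (n m : ℕ)
    (f : (Fin n → 𝒴 0) → Fin m) (g : (Fin n → 𝒴 0) → Fin ⌈(2:ℝ) ^ ((n:ℝ) * ρ)⌉₊) :
    ∃ σ : Strategy 𝒳 𝒴 𝔸 (fun _ => ρ) n,
      (∀ A (hA : A ∈ 𝔸), σ.err p A hA ≤ cost p 𝔸 A n f g) ∧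
      (∀ U, U ∉ 𝔸 → σ.leak p U + σ.unif p ≤ cost p 𝔸 U n f g) := by
  have hq : IsPMF (iid p n) := isPMF_pi hp n
  choose dec hdec using fun A : Finset (Fin L) =>
    exists_dec (iid p n) (Yn 𝒳 𝒴 n) (XTn A n) f
  let σ : Strategy 𝒳 𝒴 𝔸 (fun _ => ρ) n :=
    { msgCard := fun _ => m
      encM := fun d y => f (fun i => (Subsingleton.elim d 0 : d = 0) ▸ y i)
      encS := fun d y => g (fun i => (Subsingleton.elim d 0 : d = 0) ▸ y i)
      dec := fun A _ x mm _ => g (dec A x (mm 0)) }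
  have hM : ∀ ω d, σ.Mrv ω d = f (Yn 𝒳 𝒴 n ω) := by
    intro ω d
    have hd : d = 0 := Subsingleton.elim _ _
    subst hd
    rfl
  have hS : ∀ ω d, σ.Srv ω d = g (Yn 𝒳 𝒴 n ω) := by
    intro ω d
    have hd : d = 0 := Subsingleton.elim _ _
    subst hd
    rfl
  refine ⟨σ, fun A hA => ?_, fun U hU => ?_⟩
  · simp only [cost, hA, if_true, Strategy.err]
    refine Finset.sum_le_sum fun ω _ => ?_
    by_cases hb : Bad (iid p n) (Yn 𝒳 𝒴 n) (XTn A n) f ω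
    · rw [if_pos hb]
      split_ifs
      · exact le_rfl
      · exact hq.1 ω
    · rw [if_neg hb, if_neg]
      rw [not_not]
      funext d
      rw [hS]
      change g (dec A (XTn A n ω) (σ.Mrv ω 0)) = _
      rw [hM, hdec A ω hb]
  · have hl : σ.leak p U = ent (iid p n) σ.Srv + ent (iid p n) (fun ω => (σ.Mrv ω, XTn U n ω)) -
      ent (iid p n) (fun ω => (σ.Srv ω, σ.Mrv ω, XTn U n ω)) := rfl
    have hu : σ.unif p = Real.logb 2 (⌈(2:ℝ) ^ ((n:ℝ) * ρ)⌉₊ : ℕ) - ent (iid p n) σ.Srv := by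
      simp [Strategy.unif, secCard]
    have hMi : ∀ ω ω', σ.Mrv ω' = σ.Mrv ω ↔ f (Yn 𝒳 𝒴 n ω') = f (Yn 𝒳 𝒴 n ω) := by
      intro ω ω'
      constructor
      · intro h
        have := congrFun h 0
        rwa [hM, hM] at this
      · intro h
        funext d
        rw [hM, hM, h]
    have hSi : ∀ ω ω', σ.Srv ω' = σ.Srv ω ↔ g (Yn 𝒳 𝒴 n ω') = g (Yn 𝒳 𝒴 n ω) := by
      intro ω ω'
      constructor
      · intro h
        have := congrFun h 0
        rwa [hS, hS] at this
      · intro h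
        funext d
        rw [hS, hS, h]
    have r1 : ent (iid p n) (fun ω => (σ.Mrv ω, XTn U n ω)) =
        ent (iid p n) (fun ω => (f (Yn 𝒳 𝒴 n ω), XTn U n ω)) := by
      refine ent_congr _ _ _ fun ω ω' => ?_
      simp only [Prod.mk.injEq, hMi]
    have r2 : ent (iid p n) (fun ω => (σ.Srv ω, σ.Mrv ω, XTn U n ω)) =
        ent (iid p n) (fun ω => (g (Yn 𝒳 𝒴 n ω), f (Yn 𝒳 𝒴 n ω), XTn U n ω)) := by
      refine ent_congr _ _ _ fun ω ω' => ?_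
      simp only [Prod.mk.injEq, hMi, hSi]
    have h2 := ent_pair_le hq (fun ω => f (Yn 𝒳 𝒴 n ω)) (XTn U n)
    have h4 := ent_le_log hq (fun ω => f (Yn 𝒳 𝒴 n ω))
    simp only [cost, hU, if_false, secDef]
    rw [hl, hu, r1, r2, Fintype.card_fin, Fintype.card_fin]
    rw [Fintype.card_fin] at h4
    linarith

lemma achiev {L : ℕ} {𝒳 : Fin L → Type} {𝒴 : Fin 1 → Type}
    [∀ l, Fintype (𝒳 l)] [∀ d, Fintype (𝒴 d)] [∀ d, Nonempty (𝒴 d)]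
    {p : Base 𝒳 𝒴 → ℝ} (hp : IsPMF p) (𝔸 : Set (Finset (Fin L))) (hne : ∅ ∉ 𝔸)
    {R RM : ℝ} (hR : 0 ≤ R) (hRM : 0 ≤ RM) (hA : ∀ T, T ∈ 𝔸 → hT p T < RM)
    (hU : ∀ T, T ∉ 𝔸 → RM + R < hT p T) :
    Achievable p 𝔸 𝔸ᶜ (fun _ : Fin 1 => R) := by
  refine ⟨fun _ => hR, ?_⟩
  choose c θ hθ hθ1 hb using fun T => cost_avg hp 𝔸 T hR hRM (hA T) (hU T)
  have hex : ∀ n : ℕ, ∃ σ : Strategy 𝒳 𝒴 𝔸 (fun _ => R) n,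
      (∀ A (hA : A ∈ 𝔸), σ.err p A hA ≤ ∑ T, c T * θ T ^ n) ∧
      (∀ U, U ∉ 𝔸 → σ.leak p U + σ.unif p ≤ ∑ T, c T * θ T ^ n) := by
    intro n
    have hn1 : Nonempty (Fin ⌈(2:ℝ) ^ ((n:ℝ) * RM)⌉₊) := ⟨⟨0, ceil_pos' n RM⟩⟩
    have hn2 : Nonempty (Fin ⌈(2:ℝ) ^ ((n:ℝ) * R)⌉₊) := ⟨⟨0, ceil_pos' n R⟩⟩
    have hfg : ∃ fg : ((Fin n → 𝒴 0) → Fin ⌈(2:ℝ) ^ ((n:ℝ) * RM)⌉₊) ×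
        ((Fin n → 𝒴 0) → Fin ⌈(2:ℝ) ^ ((n:ℝ) * R)⌉₊),
        ∑ T, cost p 𝔸 T n fg.1 fg.2 ≤ ∑ T, c T * θ T ^ n := by
      by_contra hcon
      push Not at hcon
      have h1 := Finset.sum_lt_sum_of_nonempty Finset.univ_nonempty
        (fun fg (_ : fg ∈ Finset.univ) => hcon fg)
      rw [Finset.sum_const, Finset.card_univ, Fintype.card_prod, nsmul_eq_mul, Finset.sum_comm,
        Finset.mul_sum] at h1
      refine absurd h1 (not_lt.mpr (Finset.sum_le_sum fun T _ => ?_))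
      rw [Fintype.sum_prod_type]
      push_cast
      exact_mod_cast hb T n
    obtain ⟨fg, hfg⟩ := hfg
    obtain ⟨σ, h1, h2⟩ := exists_strategy hp 𝔸 R n _ fg.1 fg.2
    have h3 : ∀ T, cost p 𝔸 T n fg.1 fg.2 ≤ ∑ T, c T * θ T ^ n := fun T =>
      le_trans (Finset.single_le_sum (f := fun T => cost p 𝔸 T n fg.1 fg.2)
        (fun T _ => cost_nonneg hp 𝔸 T n fg.1 fg.2) (Finset.mem_univ T)) hfg
    exact ⟨σ, fun A hA => (h1 A hA).trans (h3 A), fun U hU => (h2 U hU).trans (h3 U)⟩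
  choose σ h1 h2 using hex
  have hB : Tendsto (fun n : ℕ => ∑ T, c T * θ T ^ n) atTop (nhds 0) := by
    have : Tendsto (fun n : ℕ => ∑ T, c T * θ T ^ n) atTop
        (nhds (∑ T : Finset (Fin L), c T * 0)) :=
      tendsto_finsetSum _ fun T _ =>
        (tendsto_pow_atTop_nhds_zero_of_lt_one (hθ T) (hθ1 T)).const_mul (c T)
    simpa using this
  refine ⟨σ, fun A hA => ?_, fun U hU => ?_, ?_⟩
  · refine squeeze_zero (fun n => ?_) (fun n => h1 n A hA) hB
    have hq : IsPMF (iid p n) := isPMF_pi hp n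
    exact Finset.sum_nonneg fun ω _ => by split_ifs <;> simp [hq.1 ω]
  · refine squeeze_zero (fun n => leak_nonneg hp _ _) (fun n => ?_) hB
    have := h2 n U hU
    have := unif_nonneg hp (σ n)
    linarith
  · refine squeeze_zero (fun n => unif_nonneg hp _) (fun n => ?_) hB
    have := h2 n ∅ hne
    have := leak_nonneg hp (σ n) ∅
    linarith

lemma zero_achievable {L : ℕ} {𝒳 : Fin L → Type} {𝒴 : Fin 1 → Type}
    [∀ l, Fintype (𝒳 l)] [∀ d, Fintype (𝒴 d)]
    {p : Base 𝒳 𝒴 → ℝ} (hp : IsPMF p) (𝔸 : Set (Finset (Fin L))) :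
    Achievable p 𝔸 𝔸ᶜ (fun _ : Fin 1 => (0:ℝ)) := by
  refine ⟨fun _ => le_rfl, ?_⟩
  have hs : ∀ (n : ℕ) (d : Fin 1), secCard (fun _ : Fin 1 => (0:ℝ)) n d = 1 := by
    intro n d; simp [secCard]
  have hsub : ∀ n : ℕ, Subsingleton (∀ d : Fin 1, Fin (secCard (fun _ : Fin 1 => (0:ℝ)) n d)) := by
    intro n
    refine ⟨fun a b => ?_⟩
    funext d
    have h1 := (a d).2
    have h2 := (b d).2
    have h3 := hs n d
    ext
    omega
  have hex : ∀ n : ℕ, ∃ σ : Strategy 𝒳 𝒴 𝔸 (fun _ : Fin 1 => (0:ℝ)) n, True := fun n =>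
    ⟨{ msgCard := fun _ => 1
       encM := fun _ _ => 0
       encS := fun d _ => ⟨0, by rw [hs]; exact one_pos⟩
       dec := fun _ _ _ _ d => ⟨0, by rw [hs]; exact one_pos⟩ }, trivial⟩
  choose σ _ using hex
  have hent : ∀ n, ent (iid p n) (σ n).Srv = 0 := by
    intro n
    have hq : IsPMF (iid p n) := isPMF_pi hp n
    rw [ent_eq]
    have : ∀ ω, prob (iid p n) (σ n).Srv ((σ n).Srv ω) = 1 := by
      intro ω
      rw [prob, ← hq.2]
      refine Finset.sum_congr rfl fun ω' _ => if_pos ((hsub n).elim _ _)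
    simp [this]
  refine ⟨σ, fun A hA => ?_, fun U hU => ?_, ?_⟩
  · have : ∀ n, (σ n).err p A hA = 0 := by
      intro n
      refine Finset.sum_eq_zero fun ω _ => if_neg ?_
      rw [not_not]
      exact (hsub n).elim _ _
    simp only [this]
    exact tendsto_const_nhds
  · have : ∀ n, (σ n).leak p U = 0 := by
      intro n
      have hr : ent (iid p n) (fun ω => ((σ n).Srv ω, (σ n).Mrv ω, XTn U n ω)) =
          ent (iid p n) (fun ω => ((σ n).Mrv ω, XTn U n ω)) := by
        refine ent_congr _ _ _ fun ω ω' => ?_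
        have := (hsub n).elim ((σ n).Srv ω') ((σ n).Srv ω)
        simp [this]
      simp only [Strategy.leak, mutInf, hent, hr]
      ring
    simp only [this]
    exact tendsto_const_nhds
  · have : ∀ n, (σ n).unif p = 0 := by
      intro n
      simp [Strategy.unif, hent, hs]
    simp only [this]
    exact tendsto_const_nhds

/-- **Corollary 3 (Single-dealer capacity bounds).** The secret capacity,
i.e., the supremum of achievable rates, is lower bounded by
`min_{A ∈ 𝔸} min_{U ∈ 𝕌} (I(Y₁ ; X_A) − I(Y₁ ; X_U))` and upper bounded by
`min_{A ∈ 𝔸} min_{U ∈ 𝕌} I(Y₁ ; X_A | X_U)`. -/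
theorem single_dealer_capacity_bounds
    {L : ℕ} (hL : 1 ≤ L)
    {𝒳 : Fin L → Type} {𝒴 : Fin 1 → Type}
    [∀ l, Fintype (𝒳 l)] [∀ l, Nonempty (𝒳 l)]
    [∀ d, Fintype (𝒴 d)] [∀ d, Nonempty (𝒴 d)]
    (p : Base 𝒳 𝒴 → ℝ) (hp : IsPMF p)
    (𝔸 : Set (Finset (Fin L))) (h𝔸 : MonotoneAccess 𝔸) :
    sInf {x : ℝ | ∃ A ∈ 𝔸, ∃ U : Finset (Fin L), U ∉ 𝔸 ∧
        x = mutInf p (fun ω => ω.2 0) (XT A) - mutInf p (fun ω => ω.2 0) (XT U)}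
      ≤ sSup {ρ : ℝ | Achievable p 𝔸 𝔸ᶜ (fun _ => ρ)} ∧
    sSup {ρ : ℝ | Achievable p 𝔸 𝔸ᶜ (fun _ => ρ)}
      ≤ sInf {x : ℝ | ∃ A ∈ 𝔸, ∃ U : Finset (Fin L), U ∉ 𝔸 ∧
        x = condMutInf p (fun ω => ω.2 0) (XT A) (XT U)} := by
  obtain ⟨hAne, hemp, -⟩ := h𝔸
  obtain ⟨A₁, hA₁⟩ := hAne
  have hconv : ∀ ρ, Achievable p 𝔸 𝔸ᶜ (fun _ : Fin 1 => ρ) → ∀ x ∈ {x : ℝ | ∃ A ∈ 𝔸,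
      ∃ U : Finset (Fin L), U ∉ 𝔸 ∧ x = condMutInf p (fun ω => ω.2 0) (XT A) (XT U)},
      ρ ≤ x := by
    rintro ρ hρ x ⟨A, hA, U, hU, rfl⟩
    exact converse hp hρ A hA U hU
  have hzero := zero_achievable (𝒳 := 𝒳) (𝒴 := 𝒴) hp 𝔸
  have hbdd : BddAbove {ρ : ℝ | Achievable p 𝔸 𝔸ᶜ (fun _ => ρ)} :=
    ⟨condMutInf p (fun ω => ω.2 0) (XT A₁) (XT ∅),
      fun ρ hρ => hconv ρ hρ _ ⟨A₁, hA₁, ∅, hemp, rfl⟩⟩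
  constructor
  · refine le_of_forall_lt fun c hc => ?_
    obtain ⟨c', hcc', hc'⟩ := exists_between hc
    refine lt_of_lt_of_le hcc' ?_
    rcases lt_or_ge c' 0 with hneg | hpos
    · exact hneg.le.trans (le_csSup hbdd hzero)
    refine le_csSup hbdd ?_
    have hbelow : BddBelow {x : ℝ | ∃ A ∈ 𝔸, ∃ U : Finset (Fin L), U ∉ 𝔸 ∧
        x = mutInf p (fun ω => ω.2 0) (XT A) - mutInf p (fun ω => ω.2 0) (XT U)} := by
      refine Set.Finite.bddBelow ?_
      refine (Set.finite_range (fun t : Finset (Fin L) × Finset (Fin L) =>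
        mutInf p (fun ω => ω.2 0) (XT t.1) - mutInf p (fun ω => ω.2 0) (XT t.2))).subset ?_
      rintro x ⟨A, hA, U, hU, rfl⟩
      exact ⟨(A, U), rfl⟩
    have hlt : ∀ A ∈ 𝔸, ∀ U, U ∉ 𝔸 → c' < hT p U - hT p A := by
      intro A hA U hU
      have h1 := csInf_le hbelow ⟨A, hA, U, hU, rfl⟩
      have h2 := lt_of_lt_of_le hc' h1
      simp only [mutInf] at h2
      simp only [hT]
      linarith
    obtain ⟨A₀, hA₀, hmax⟩ := Set.exists_max_image 𝔸 (fun T => hT p T) (Set.toFinite _) ⟨A₁, hA₁⟩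
    obtain ⟨U₀, hU₀, hmin⟩ := Set.exists_min_image 𝔸ᶜ (fun T => hT p T) (Set.toFinite _) ⟨∅, hemp⟩
    have h0 := hlt A₀ hA₀ U₀ hU₀
    have hnn : 0 ≤ hT p A₀ := by
      have := ent_mono hp (fun ω => (ω.2 0, XT A₀ ω)) (XT A₀) (fun ω ω' h => (Prod.mk.inj h).2)
      simp only [hT]
      linarith
    refine achiev hp 𝔸 hemp (RM := (hT p A₀ + (hT p U₀ - c')) / 2) hpos (by linarith) ?_ ?_
    · intro T hT'
      have := hmax T hT'
      linarith
    · intro T hT'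
      have := hmin T hT'
      linarith
  · refine csSup_le ⟨0, hzero⟩ fun ρ hρ => ?_
    exact le_csInf ⟨_, A₁, hA₁, ∅, hemp, rfl⟩ (hconv ρ hρ)


end SecretSharing
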